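/- Let 1 ≤ k < n and let 𝒮 be a nonempty finite family of subsets of {1,…,k} such that for every unitary cost c ≥ 0, max_{S ∈ 𝒮} G(S,c) = max_{S ⊆ {1,…,k}} G(S,c). Let ℰ = { T ∪ {k+1} : T ∈ 𝒮 }. Then for every subset S₁ ⊆ {1,…,k+1} and every c ≥ 0, G(S₁,c) ≤ max_{S ∈ 𝒮 ∪ ℰ} G(S,c); consequently max_{S ⊆ {1,…,k+1}} G(S,c) = max_{S ∈ 𝒮 ∪ ℰ} G(S,c) for every c ≥ 0. -/

import Mathlib

open Finset

/-- Expected revenue of a set of customers. -/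
def R (pi p : ℕ → ℝ) (S : Finset ℕ) : ℝ := ∑ i ∈ S, pi i * p i

/-- Expected traveled distance (with l i = 2 * x i). -/
def L (x pi : ℕ → ℝ) (S : Finset ℕ) : ℝ :=
  ∑ i ∈ S, (2 * x i) * pi i * ∏ j ∈ S.filter (fun j => i < j), (1 - pi j)

/-- Expected profit at unitary cost c. -/
def G (x pi p : ℕ → ℝ) (S : Finset ℕ) (c : ℝ) : ℝ := R pi p S - c * L x pi S

/-- Optimal value of the probabilistic profitable tour problem on a line. -/
def PPTP (n : ℕ) (x pi p : ℕ → ℝ) (c : ℝ) : ℝ :=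
  (Finset.Icc 1 n).powerset.sup' (Finset.powerset_nonempty _) (fun S => G x pi p S c)

theorem R_insert (pi p : ℕ → ℝ) {m : ℕ} {T : Finset ℕ} (hm : m ∉ T) :
    R pi p (insert m T) = pi m * p m + R pi p T :=
  sum_insert hm

/-- A customer beyond all others scales the traveled distance of the others by `1 - pi m`. -/
theorem L_insert_of_forall_lt (x pi : ℕ → ℝ) {m : ℕ} {T : Finset ℕ} (hT : ∀ i ∈ T, i < m) :
    L x pi (insert m T) = 2 * x m * pi m + (1 - pi m) * L x pi T := by
  have hm : m ∉ T := fun h => (hT m h).false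
  have hempty : (insert m T).filter (fun j => m < j) = ∅ := by
    rw [filter_eq_empty_iff]
    intro j hj
    rcases mem_insert.1 hj with rfl | hj
    · exact lt_irrefl _
    · exact (hT j hj).not_gt
  unfold L
  rw [sum_insert hm, hempty, prod_empty, mul_one, mul_sum]
  congr 1
  refine sum_congr rfl fun i hi => ?_
  rw [filter_insert, if_pos (hT i hi), prod_insert (by simp [hm])]
  ring

/-- Adding the farthest customer amounts to rescaling the unitary cost, up to a constant. -/
theorem G_insert_of_forall_lt (x pi p : ℕ → ℝ) {m : ℕ} {T : Finset ℕ} (hT : ∀ i ∈ T, i < m)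
    (c : ℝ) :
    G x pi p (insert m T) c =
      G x pi p T (c * (1 - pi m)) + pi m * (p m - c * (2 * x m)) := by
  unfold G
  rw [R_insert pi p (fun h => (hT m h).false), L_insert_of_forall_lt x pi hT]
  ring

theorem stmt19 (n : ℕ) (x p pi : ℕ → ℝ)
    (hx : ∀ i ∈ Finset.Icc 1 n, 0 < x i)
    (hxmono : ∀ i, 1 ≤ i → i + 1 ≤ n → x i ≤ x (i + 1))
    (hp : ∀ i ∈ Finset.Icc 1 n, 0 < p i)
    (hpi : ∀ i ∈ Finset.Icc 1 n, 0 < pi i ∧ pi i ≤ 1)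
    (k : ℕ) (hk1 : 1 ≤ k) (hkn : k < n)
    (𝓢 : Finset (Finset ℕ)) (h𝓢ne : 𝓢.Nonempty)
    (h𝓢sub : ∀ S ∈ 𝓢, S ⊆ Finset.Icc 1 k)
    (henv : ∀ c : ℝ, 0 ≤ c →
      𝓢.sup' h𝓢ne (fun S => G x pi p S c) =
        (Finset.Icc 1 k).powerset.sup' (Finset.powerset_nonempty _) (fun S => G x pi p S c)) :
    (∀ S₁ : Finset ℕ, S₁ ⊆ Finset.Icc 1 (k + 1) → ∀ c : ℝ, 0 ≤ c →
      G x pi p S₁ c ≤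
        (𝓢 ∪ 𝓢.image (insert (k + 1))).sup' h𝓢ne.inl (fun S => G x pi p S c)) ∧
    (∀ c : ℝ, 0 ≤ c →
      (Finset.Icc 1 (k + 1)).powerset.sup' (Finset.powerset_nonempty _) (fun S => G x pi p S c) =
        (𝓢 ∪ 𝓢.image (insert (k + 1))).sup' h𝓢ne.inl (fun S => G x pi p S c)) := by
  have lt_of_subset : ∀ T : Finset ℕ, T ⊆ Icc 1 k → ∀ i ∈ T, i < k + 1 := fun T hT i hi =>
    Nat.lt_succ_of_le (mem_Icc.1 (hT hi)).2
  have exists_ge : ∀ T : Finset ℕ, T ⊆ Icc 1 k → ∀ c : ℝ, 0 ≤ c →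
      ∃ S ∈ 𝓢, G x pi p T c ≤ G x pi p S c := by
    intro T hT c hc
    rw [← le_sup'_iff h𝓢ne (f := fun S => G x pi p S c), henv c hc]
    exact le_sup' (fun S => G x pi p S c) (mem_powerset.2 hT)
  have key : ∀ S₁ : Finset ℕ, S₁ ⊆ Icc 1 (k + 1) → ∀ c : ℝ, 0 ≤ c →
      G x pi p S₁ c ≤
        (𝓢 ∪ 𝓢.image (insert (k + 1))).sup' h𝓢ne.inl (fun S => G x pi p S c) := by
    intro S₁ hS₁ c hc
    rw [le_sup'_iff]
    have hsub : S₁.erase (k + 1) ⊆ Icc 1 k := by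
      intro i hi
      have hne := ne_of_mem_erase hi
      have hmem := mem_Icc.1 (hS₁ (mem_of_mem_erase hi))
      exact mem_Icc.2 ⟨hmem.1, by omega⟩
    by_cases hk : k + 1 ∈ S₁
    · have hpik := (hpi (k + 1) (mem_Icc.2 ⟨by omega, hkn⟩)).2
      obtain ⟨S, hS, hle⟩ := exists_ge _ hsub (c * (1 - pi (k + 1)))
        (mul_nonneg hc (sub_nonneg.2 hpik))
      refine ⟨insert (k + 1) S, mem_union_right _ (mem_image_of_mem _ hS), ?_⟩
      rw [← insert_erase hk, G_insert_of_forall_lt x pi p (lt_of_subset _ hsub),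
        G_insert_of_forall_lt x pi p (lt_of_subset _ (h𝓢sub S hS))]
      gcongr
    · rw [erase_eq_of_notMem hk] at hsub
      obtain ⟨S, hS, hle⟩ := exists_ge _ hsub c hc
      exact ⟨S, mem_union_left _ hS, hle⟩
  refine ⟨key, fun c hc => le_antisymm
    (sup'_le _ _ fun S hS => key S (mem_powerset.1 hS) c hc) (sup'_mono _ ?_ _)⟩
  have hIcc : Icc 1 k ⊆ Icc 1 (k + 1) := Icc_subset_Icc_right k.le_succ
  intro S hS
  rw [mem_powerset]
  rcases mem_union.1 hS with hS | hS
  · exact (h𝓢sub S hS).trans hIcc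
  · obtain ⟨T, hT, rfl⟩ := mem_image.1 hS
    exact insert_subset (mem_Icc.2 ⟨by omega, le_rfl⟩) ((h𝓢sub T hT).trans hIcc)
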